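/- Let I be the two-sided ideal of B = A[X;*]^fl generated by X² − μ. Then I is invariant under the involution α of B, the quotient B/I is a *-algebra with involution [p]* := [α(p)], and the K-linear map φ : B/I → Cay(A,μ) determined by φ([a + bX]) = (a, b) is a well-defined bijective K-algebra homomorphism satisfying φ([p]*) = φ([p])*; in particular Cay(A,μ) and A[X;*]^fl/⟨X² − μ⟩ are isomorphic as *-algebras. -/

import Mathlib

/-- `tau n a b = ab` if `n` is even and `ba` if `n` is odd. -/
def tau {A : Type*} [NonAssocRing A] (n : ℕ) (a b : A) : A :=
  if Even n then a * b else b * a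

/-- The `m`-fold iterate `*^m` of the involution `*`. -/
def starIter {A : Type*} [NonAssocRing A] [StarRing A] : ℕ → A → A
  | 0, a => a
  | m+1, a => star (starIter m a)

/-- The multiplication of the flipped non-associative skew polynomial ring `B = A[X;*]^fl`:
the biadditive extension of `(aX^m)(bX^n) = τ_n(a, *^m(b)) X^{m+n}`. Polynomials are
represented as finitely supported functions `ℕ →₀ A`. -/
noncomputable def fmul {A : Type*} [NonAssocRing A] [StarRing A] (p q : ℕ →₀ A) : ℕ →₀ A :=
  p.sum fun m a => q.sum fun n b => Finsupp.single (m+n) (tau n a (starIter m b))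

/-- The map `α : B → B`, `α(Σ_i a_i X^i) = Σ_i (−1)^i *^{i+1}(a_i) X^i`. -/
noncomputable def alphaMap {A : Type*} [NonAssocRing A] [StarRing A] (p : ℕ →₀ A) : ℕ →₀ A :=
  p.sum fun i a => Finsupp.single i ((-1 : ℤ) ^ i • starIter (i+1) a)

/-- The map `β : B → B`, `β(Σ_i a_i X^i) = Σ_i *^{i+1}(a_i) X^i`. -/
noncomputable def betaMap {A : Type*} [NonAssocRing A] [StarRing A] (p : ℕ →₀ A) : ℕ →₀ A :=
  p.sum fun i a => Finsupp.single i (starIter (i+1) a)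

/-- The product of the Cayley double `Cay(A,μ) = A ⊕ A`:
`(a,b)(c,d) = (ac + μ d*b, da + bc*)`. -/
def cayMul {K A : Type*} [CommRing K] [NonAssocRing A] [Module K A] [StarRing A]
    (μ : K) (x y : A × A) : A × A :=
  (x.1 * y.1 + μ • (star y.2 * x.2), y.2 * x.1 + x.2 * star y.1)

/-- The involution of the Cayley double: `(a,b)* = (a*, −b)`. -/
def cayStar {A : Type*} [NonAssocRing A] [StarRing A] (x : A × A) : A × A :=
  (star x.1, -x.2)

/-- The two-sided ideal of `B = A[X;*]^fl` generated by an element `g`: the smallest set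
containing `g`, closed under addition and negation, and under multiplication by arbitrary
elements of `B` on either side. -/
inductive genIdeal {A : Type*} [NonAssocRing A] [StarRing A] (g : ℕ →₀ A) : (ℕ →₀ A) → Prop
  | base : genIdeal g g
  | add : ∀ p q, genIdeal g p → genIdeal g q → genIdeal g (p + q)
  | neg : ∀ p, genIdeal g p → genIdeal g (-p)
  | mul_left : ∀ p q, genIdeal g q → genIdeal g (fmul p q)
  | mul_right : ∀ p q, genIdeal g p → genIdeal g (fmul p q)

section Multiplication

variable {A : Type*} [NonAssocRing A]

theorem tau_add_left (n : ℕ) (a b c : A) : tau n (a + b) c = tau n a c + tau n b c := by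
  unfold tau; split_ifs <;> simp [add_mul, mul_add]

theorem tau_add_right (n : ℕ) (a b c : A) : tau n a (b + c) = tau n a b + tau n a c := by
  unfold tau; split_ifs <;> simp [add_mul, mul_add]

@[simp]
theorem tau_zero_left (n : ℕ) (a : A) : tau n 0 a = 0 := by
  simp [tau]

@[simp]
theorem tau_zero_right (n : ℕ) (a : A) : tau n a 0 = 0 := by
  simp [tau]

variable [StarRing A]

theorem starIter_of_even {n : ℕ} (hn : Even n) (a : A) : starIter n a = a := by
  obtain ⟨k, rfl⟩ := hn
  induction k with
  | zero => rfl
  | succ k ih =>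
    rw [show k + 1 + (k + 1) = k + k + 1 + 1 by lia]
    simp [starIter, ih]

theorem starIter_of_odd {n : ℕ} (hn : Odd n) (a : A) : starIter n a = star a := by
  obtain ⟨k, rfl⟩ := hn
  exact congrArg star (starIter_of_even (even_two_mul k) a)

@[simp]
theorem starIter_zero (n : ℕ) : starIter n (0 : A) = 0 := by
  rcases n.even_or_odd with h | h <;> simp [starIter_of_even, starIter_of_odd, h]

theorem starIter_add (n : ℕ) (a b : A) : starIter n (a + b) = starIter n a + starIter n b := by
  rcases n.even_or_odd with h | h <;> simp [starIter_of_even, starIter_of_odd, h]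

theorem fmul_single_single (m n : ℕ) (a b : A) :
    fmul (Finsupp.single m a) (Finsupp.single n b) =
      Finsupp.single (m + n) (tau n a (starIter m b)) := by
  simp [fmul]

theorem fmul_zero_left (q : ℕ →₀ A) : fmul 0 q = 0 := by
  simp [fmul]

theorem fmul_zero_right (p : ℕ →₀ A) : fmul p 0 = 0 := by
  simp [fmul]

theorem fmul_add_left (p q r : ℕ →₀ A) : fmul (p + q) r = fmul p r + fmul q r := by
  unfold fmul
  refine Finsupp.sum_add_index' (by simp) fun m a b => ?_
  simp [tau_add_left, Finsupp.sum_add]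

theorem fmul_add_right (p q r : ℕ →₀ A) : fmul p (q + r) = fmul p q + fmul p r := by
  unfold fmul
  rw [← Finsupp.sum_add]
  refine Finsupp.sum_congr fun m _ => Finsupp.sum_add_index' (by simp) fun n a b => ?_
  simp [starIter_add, tau_add_right]

theorem fmul_sub_right (p q r : ℕ →₀ A) : fmul p (q - r) = fmul p q - fmul p r := by
  rw [eq_sub_iff_add_eq, ← fmul_add_right, sub_add_cancel]

theorem alphaMap_zero : alphaMap (0 : ℕ →₀ A) = 0 := by
  simp [alphaMap]

theorem alphaMap_add (p q : ℕ →₀ A) : alphaMap (p + q) = alphaMap p + alphaMap q :=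
  Finsupp.sum_add_index' (by simp) fun i a b => by simp [starIter_add]

theorem alphaMap_single (i : ℕ) (a : A) :
    alphaMap (Finsupp.single i a) = Finsupp.single i ((-1 : ℤ) ^ i • starIter (i + 1) a) := by
  simp [alphaMap]

theorem cayStar_add (x y : A × A) : cayStar (x + y) = cayStar x + cayStar y := by
  ext <;> simp [cayStar, add_comm]

theorem genIdeal.zero (g : ℕ →₀ A) : genIdeal g 0 := by
  simpa using (genIdeal.base (g := g)).add _ _ (genIdeal.base.neg g)

end Multiplication

section CayleyDouble

variable {K A : Type*} [CommRing K] [NonAssocRing A] [Module K A]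

/-- The reduction of a skew polynomial modulo `X² = μ`: it sends `a X^(2k)` to `(μ^k a, 0)` and
`a X^(2k+1)` to `(0, μ^k a)`. -/
noncomputable def cayleyReduction (μ : K) : (ℕ →₀ A) →ₗ[K] A × A :=
  Finsupp.lsum K fun i =>
    μ ^ (i / 2) • if Even i then LinearMap.inl K A A else LinearMap.inr K A A

theorem cayleyReduction_single_of_even (μ : K) {i : ℕ} (hi : Even i) (a : A) :
    cayleyReduction μ (Finsupp.single i a) = (μ ^ (i / 2) • a, 0) := by
  simp [cayleyReduction, hi]

theorem cayleyReduction_single_of_odd (μ : K) {i : ℕ} (hi : Odd i) (a : A) :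
    cayleyReduction μ (Finsupp.single i a) = (0, μ ^ (i / 2) • a) := by
  simp [cayleyReduction, Nat.not_even_iff_odd.2 hi]

theorem cayleyReduction_add_single (μ : K) (a b : A) :
    cayleyReduction μ (Finsupp.single 0 a + Finsupp.single 1 b) = (a, b) := by
  simp [map_add, cayleyReduction_single_of_even, cayleyReduction_single_of_odd]

theorem cayleyReduction_X_sq_sub (μ : K) :
    cayleyReduction μ
      (Finsupp.single 2 (1 : A) - Finsupp.single 0 (μ • (1 : A))) = 0 := by
  simp [map_sub, cayleyReduction_single_of_even]

variable [StarRing A]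

theorem cayMul_add_left (μ : K) (x y z : A × A) :
    cayMul μ (x + y) z = cayMul μ x z + cayMul μ y z := by
  ext <;> simp only [cayMul, Prod.fst_add, Prod.snd_add, add_mul, mul_add, smul_add] <;> abel

theorem cayMul_add_right (μ : K) (x y z : A × A) :
    cayMul μ x (y + z) = cayMul μ x y + cayMul μ x z := by
  ext <;>
    simp only [cayMul, Prod.fst_add, Prod.snd_add, add_mul, mul_add, smul_add, star_add] <;> abel

theorem cayMul_zero_left (μ : K) (x : A × A) : cayMul μ 0 x = 0 := by
  simp [cayMul]

theorem cayMul_zero_right (μ : K) (x : A × A) : cayMul μ x 0 = 0 := by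
  simp [cayMul]

theorem cayleyReduction_alphaMap (hstar : ∀ (k : K) (a : A), star (k • a) = k • star a) (μ : K)
    (p : ℕ →₀ A) : cayleyReduction μ (alphaMap p) = cayStar (cayleyReduction μ p) := by
  induction p using Finsupp.induction_linear with
  | zero => ext <;> simp [alphaMap_zero, cayStar]
  | add p q hp hq => simp [alphaMap_add, cayStar_add, hp, hq]
  | single i a =>
    rw [alphaMap_single]
    rcases i.even_or_odd with hi | hi
    · simp [cayleyReduction_single_of_even, hi, starIter_of_odd hi.add_one, cayStar, hstar]
    · simp [cayleyReduction_single_of_odd, hi, starIter_of_even hi.add_one, cayStar]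

variable [SMulCommClass K A A]

theorem single_add_two_sub_mem (hstar : ∀ (k : K) (a : A), star (k • a) = k • star a) (μ : K)
    (n : ℕ) (a : A) :
    genIdeal (Finsupp.single 2 (1 : A) - Finsupp.single 0 (μ • (1 : A)))
      (Finsupp.single (n + 2) a - Finsupp.single n (μ • a)) := by
  have h := genIdeal.mul_left (Finsupp.single n a) _
    (genIdeal.base (g := Finsupp.single 2 (1 : A) - Finsupp.single 0 (μ • (1 : A))))
  rw [fmul_sub_right, fmul_single_single, fmul_single_single] at h
  rcases n.even_or_odd with hn | hn
  · simpa [tau, starIter_of_even hn, mul_smul_comm] using h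
  · simpa [tau, starIter_of_odd hn, mul_smul_comm, hstar] using h

/-- Every skew polynomial is congruent to its reduction `a + b X` modulo `X² - μ`. -/
theorem sub_cayleyReduction_mem (hstar : ∀ (k : K) (a : A), star (k • a) = k • star a) (μ : K)
    (p : ℕ →₀ A) :
    genIdeal (Finsupp.single 2 (1 : A) - Finsupp.single 0 (μ • (1 : A)))
      (p - (Finsupp.single 0 (cayleyReduction μ p).1 +
        Finsupp.single 1 (cayleyReduction μ p).2)) := by
  induction p using Finsupp.induction_linear with
  | zero => simpa using genIdeal.zero _
  | add p q hp hq =>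
    convert hp.add _ _ hq using 1
    simp only [map_add, Prod.fst_add, Prod.snd_add, Finsupp.single_add]
    abel
  | single n a =>
    induction n using Nat.twoStepInduction generalizing a with
    | zero => simpa [cayleyReduction] using genIdeal.zero _
    | one => simpa [cayleyReduction] using genIdeal.zero _
    | more n ih _ =>
      have h : cayleyReduction μ (Finsupp.single (n + 2) a) =
          cayleyReduction μ (Finsupp.single n (μ • a)) := by
        rcases n.even_or_odd with hn | hn
        · simp [cayleyReduction_single_of_even, hn, hn.add even_two, smul_smul, pow_succ]
        · simp [cayleyReduction_single_of_odd, hn, hn.add_even even_two, smul_smul, pow_succ]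
      rw [h]
      simpa using (single_add_two_sub_mem hstar μ n a).add _ _ (ih (μ • a))

variable [IsScalarTower K A A]

theorem cayleyReduction_fmul_single (hstar : ∀ (k : K) (a : A), star (k • a) = k • star a)
    (μ : K) (m n : ℕ) (a b : A) :
    cayleyReduction μ (fmul (Finsupp.single m a) (Finsupp.single n b)) =
      cayMul μ (cayleyReduction μ (Finsupp.single m a))
        (cayleyReduction μ (Finsupp.single n b)) := by
  rw [fmul_single_single]
  rcases m.even_or_odd with hm | hm <;> rcases n.even_or_odd with hn | hn
  · have h : (m + n) / 2 = m / 2 + n / 2 := by grind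
    simp [-Finsupp.single_mul,
      cayleyReduction_single_of_even, hm, hn, hm.add hn, tau, starIter_of_even, cayMul, h,
      smul_mul_assoc, mul_smul_comm, smul_smul, pow_add, mul_comm]
  · have h : (m + n) / 2 = m / 2 + n / 2 := by grind
    simp [-Finsupp.single_mul,
      cayleyReduction_single_of_even, cayleyReduction_single_of_odd, hm, hn, hm.add_odd hn,
      tau, Nat.not_even_iff_odd.2 hn, starIter_of_even, cayMul, h,
      smul_mul_assoc, mul_smul_comm, smul_smul, pow_add]
  · have h : (m + n) / 2 = m / 2 + n / 2 := by grind
    simp [-Finsupp.single_mul,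
      cayleyReduction_single_of_even, cayleyReduction_single_of_odd, hm, hn, hm.add_even hn,
      tau, starIter_of_odd, cayMul, h, hstar,
      smul_mul_assoc, mul_smul_comm, smul_smul, pow_add, mul_comm]
  · have h : (m + n) / 2 = m / 2 + n / 2 + 1 := by grind
    simp [-Finsupp.single_mul,
      cayleyReduction_single_of_even, cayleyReduction_single_of_odd, hm, hn, hm.add_odd hn,
      tau, Nat.not_even_iff_odd.2 hn, starIter_of_odd, cayMul, h, hstar,
      smul_mul_assoc, mul_smul_comm, smul_smul, pow_add, mul_comm]

theorem cayleyReduction_fmul (hstar : ∀ (k : K) (a : A), star (k • a) = k • star a) (μ : K)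
    (p q : ℕ →₀ A) :
    cayleyReduction μ (fmul p q) = cayMul μ (cayleyReduction μ p) (cayleyReduction μ q) := by
  induction p using Finsupp.induction_linear with
  | zero => simp [fmul_zero_left, cayMul_zero_left]
  | add p p' hp hp' => simp [fmul_add_left, cayMul_add_left, hp, hp']
  | single m a =>
    induction q using Finsupp.induction_linear with
    | zero => simp [fmul_zero_right, cayMul_zero_right]
    | add q q' hq hq' => simp [fmul_add_right, cayMul_add_right, hq, hq']
    | single n b => exact cayleyReduction_fmul_single hstar μ m n a b

theorem cayleyReduction_eq_zero_iff (hstar : ∀ (k : K) (a : A), star (k • a) = k • star a)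
    (μ : K) (p : ℕ →₀ A) :
    cayleyReduction μ p = 0 ↔
      genIdeal (Finsupp.single 2 (1 : A) - Finsupp.single 0 (μ • (1 : A))) p := by
  refine ⟨fun h => by simpa [h] using sub_cayleyReduction_mem hstar μ p, fun h => ?_⟩
  induction h with
  | base => exact cayleyReduction_X_sq_sub μ
  | add p q _ _ hp hq => simp [hp, hq]
  | neg p _ hp => simp [hp]
  | mul_left p q _ hq => rw [cayleyReduction_fmul hstar, hq, cayMul_zero_right]
  | mul_right p q _ hp => rw [cayleyReduction_fmul hstar, hp, cayMul_zero_left]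

end CayleyDouble

/-- the ideal `I = ⟨X² − μ⟩` of `B = A[X;*]^fl` is invariant under the
involution `α`, and `B/I ≅ Cay(A,μ)` as `*`-algebras over `K`; concretely, there is a
`K`-linear multiplicative surjection `ψ : B → Cay(A,μ)` with kernel exactly `I`, sending
`a + bX` to `(a,b)` and intertwining `α` with the involution of `Cay(A,μ)` (`ψ` descends
to the well-defined bijective `*`-algebra isomorphism `φ : B/I → Cay(A,μ)`,
`φ([a + bX]) = (a,b)`). -/
theorem quotient_iso_cayley_double
    {K A : Type*} [CommRing K] [NonAssocRing A] [Module K A]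
    [SMulCommClass K A A] [IsScalarTower K A A] [StarRing A]
    (hstar : ∀ (k : K) (a : A), star (k • a) = k • star a)
    (hfaithful : ∀ k : K, (∀ a : A, k • a = 0) → k = 0)
    (μ : K) (hμ : ∀ a : A, μ • a = 0 → a = 0) :
    (∀ p : ℕ →₀ A,
      genIdeal (Finsupp.single 2 (1 : A) - Finsupp.single 0 (μ • (1 : A))) p →
      genIdeal (Finsupp.single 2 (1 : A) - Finsupp.single 0 (μ • (1 : A))) (alphaMap p)) ∧
    ∃ ψ : (ℕ →₀ A) → A × A,
      (∀ p q : ℕ →₀ A, ψ (p + q) = ψ p + ψ q) ∧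
      (∀ (k : K) (p : ℕ →₀ A), ψ (k • p) = k • ψ p) ∧
      (∀ p q : ℕ →₀ A, ψ (fmul p q) = cayMul μ (ψ p) (ψ q)) ∧
      ψ (Finsupp.single 0 (1 : A)) = (1, 0) ∧
      Function.Surjective ψ ∧
      (∀ a b : A, ψ (Finsupp.single 0 a + Finsupp.single 1 b) = (a, b)) ∧
      (∀ p : ℕ →₀ A, ψ p = 0 ↔
        genIdeal (Finsupp.single 2 (1 : A) - Finsupp.single 0 (μ • (1 : A))) p) ∧
      (∀ p : ℕ →₀ A, ψ (alphaMap p) = cayStar (ψ p)) := by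
  refine ⟨fun p hp => ?_, cayleyReduction μ, map_add _, map_smul _, cayleyReduction_fmul hstar μ,
    ?_, fun x => ⟨_, cayleyReduction_add_single μ x.1 x.2⟩, cayleyReduction_add_single μ,
    cayleyReduction_eq_zero_iff hstar μ, cayleyReduction_alphaMap hstar μ⟩
  · rw [← cayleyReduction_eq_zero_iff hstar] at hp ⊢
    simp [cayleyReduction_alphaMap hstar, hp, cayStar]
  · simpa using cayleyReduction_add_single μ (1 : A) 0
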